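/- Let N < −1 be a real number, let −∞ ≤ a < 0 < b ≤ ∞, and let w : (a,b) → (0,∞) be an integrable function such that x ↦ w(x)^{1/(N-1)} is convex on (a,b), ∫_a^b w(x) dx = 1, and ∫_a^b x·w(x) dx = 0. If equality ∫_a^0 w(x) dx = (N/(N+1))^N holds, then there exists c > 0 such that a = −∞, b = 1/c, and w(x) = c·(N/(N+1))^N·(1 + (c/N)·x)^{N-1} for all x ∈ (a,b). -/

import Mathlib

open MeasureTheory

/-- The set of real numbers lying strictly between two extended real numbers. -/
def erealIoo (a b : EReal) : Set ℝ := {x : ℝ | a < (x : EReal) ∧ (x : EReal) < b}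

lemma integrableOn_one_add_mul_rpow_Iio {k q s : ℝ} (hk : k < 0) (hq : q < -1)
    (hs : 0 < 1 + k * s) : IntegrableOn (fun x : ℝ => (1 + k * x) ^ q) (Set.Iio s) := by
  have hkk : 0 < -k := neg_pos.2 hk
  have hs' : -(-1 / k) < -s := by
    rw [← neg_div, neg_neg, div_lt_iff_of_neg hk]
    linarith
  have h := ((integrableOn_add_rpow_Ioi_of_lt hq hs').comp_neg_Iio).const_mul ((-k) ^ q)
  refine IntegrableOn.congr_fun h (fun x hx => ?_) measurableSet_Iio
  have hx : x < s := hx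
  have h1 : 0 ≤ -x + -1 / k := by
    have : -(-1 / k) < -x := by linarith
    linarith
  rw [← Real.mul_rpow hkk.le h1]
  have hk0 := hk.ne
  congr 1
  field_simp
  ring

lemma integral_one_add_mul_rpow_Iio {k q s : ℝ} (hk : k < 0) (hq : q < -1)
    (hs : 0 < 1 + k * s) :
    ∫ x in Set.Iio s, (1 + k * x) ^ q = (1 + k * s) ^ (q + 1) / (k * (q + 1)) := by
  have hq1 : q + 1 ≠ 0 := by linarith
  rw [← integral_Iic_eq_integral_Iio]
  have hd : ∀ x ∈ Set.Iic s, HasDerivAt (fun x : ℝ => (1 + k * x) ^ (q + 1) / (k * (q + 1)))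
      ((1 + k * x) ^ q) x := by
    intro x hx
    have hx : x ≤ s := hx
    have hpos : 0 < 1 + k * x := by nlinarith
    have h1 : HasDerivAt (fun x : ℝ => 1 + k * x) k x := by
      simpa using ((hasDerivAt_id x).const_mul k).const_add 1
    convert! (h1.rpow_const (p := q + 1) (Or.inl hpos.ne')).div_const (k * (q + 1)) using 1
    rw [add_sub_cancel_right]
    field_simp [hk.ne]
  have hlim : Filter.Tendsto (fun x : ℝ => (1 + k * x) ^ (q + 1) / (k * (q + 1))) Filter.atBot
      (nhds 0) := by
    have h2 : Filter.Tendsto (fun x : ℝ => 1 + k * x) Filter.atBot Filter.atTop :=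
      Filter.tendsto_atTop_add_const_left _ _ (Filter.tendsto_id.const_mul_atBot_of_neg hk)
    have h3 := (tendsto_rpow_neg_atTop (y := -(q + 1)) (by linarith)).comp h2
    simpa using h3.div_const (k * (q + 1))
  rw [integral_Iic_of_hasDerivAt_of_tendsto' hd ?_ hlim, sub_zero]
  exact (integrableOn_Iic_iff_integrableOn_Iio).2 (integrableOn_one_add_mul_rpow_Iio hk hq hs)

lemma mul_one_add_mul_rpow {k q x : ℝ} (hk : k ≠ 0) (hx : 0 < 1 + k * x) :
    x * (1 + k * x) ^ q = ((1 + k * x) ^ (q + 1) - (1 + k * x) ^ q) / k := by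
  rw [Real.rpow_add_one hx.ne']
  field_simp
  ring

lemma one_add_mul_pos_of_lt {k s x : ℝ} (hk : k < 0) (hs : 0 < 1 + k * s) (hx : x < s) :
    0 < 1 + k * x := by
  nlinarith

lemma integrableOn_mul_one_add_mul_rpow_Iio {k q s : ℝ} (hk : k < 0) (hq : q < -2)
    (hs : 0 < 1 + k * s) : IntegrableOn (fun x : ℝ => x * (1 + k * x) ^ q) (Set.Iio s) := by
  have h := ((integrableOn_one_add_mul_rpow_Iio hk (by linarith : q + 1 < -1) hs).sub
    (integrableOn_one_add_mul_rpow_Iio hk (by linarith : q < -1) hs)).div_const k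
  exact IntegrableOn.congr_fun h (fun x hx =>
    (mul_one_add_mul_rpow hk.ne (one_add_mul_pos_of_lt hk hs hx)).symm) measurableSet_Iio

lemma integral_mul_one_add_mul_rpow_Iio {k q s : ℝ} (hk : k < 0) (hq : q < -2)
    (hs : 0 < 1 + k * s) :
    ∫ x in Set.Iio s, x * (1 + k * x) ^ q =
      ((1 + k * s) ^ (q + 2) / (k * (q + 2)) - (1 + k * s) ^ (q + 1) / (k * (q + 1))) / k := by
  rw [setIntegral_congr_fun measurableSet_Iio (fun x hx =>
    mul_one_add_mul_rpow hk.ne (one_add_mul_pos_of_lt hk hs hx)), integral_div,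
    integral_sub (integrableOn_one_add_mul_rpow_Iio hk (by linarith) hs)
      (integrableOn_one_add_mul_rpow_Iio hk (by linarith) hs),
    integral_one_add_mul_rpow_Iio hk (by linarith) hs,
    integral_one_add_mul_rpow_Iio hk (by linarith) hs]
  norm_num [add_assoc]

/-- A convex function on `[0, ∞)` whose `q`-th power is integrable for some `q < -2` grows at
least linearly, so that this power also has a finite first moment. -/
lemma integrableOn_mul_rpow_Ioi_of_convexOn {f : ℝ → ℝ} {q : ℝ} (hq : q < -2)
    (hf : ConvexOn ℝ (Set.Ici 0) f) (hpos : ∀ x ∈ Set.Ici (0 : ℝ), 0 < f x)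
    (hint : IntegrableOn (fun x => f x ^ q) (Set.Ioi 0)) :
    IntegrableOn (fun x => x * f x ^ q) (Set.Ioi 0) := by
  have h0 := hpos 0 Set.self_mem_Ici
  obtain ⟨y, hy0, hy⟩ : ∃ y, 0 < y ∧ f 0 < f y := by
    by_contra! hcon
    have hc : IntegrableOn (fun _ : ℝ => f 0 ^ q) (Set.Ioi 0) := by
      refine Integrable.mono' hint aestronglyMeasurable_const ?_
      filter_upwards [ae_restrict_mem measurableSet_Ioi] with x hx
      rw [Real.norm_of_nonneg (Real.rpow_nonneg h0.le _)]
      exact Real.rpow_le_rpow_of_nonpos (hpos x (Set.Ioi_subset_Ici_self hx)) (hcon x hx)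
        (by linarith)
    rw [integrableOn_const_iff] at hc
    simp [(Real.rpow_pos_of_pos h0 q).ne'] at hc
  set δ := (f y - f 0) / y with hδ
  have hδ0 : 0 < δ := div_pos (by linarith) hy0
  have hlow : ∀ x, y < x → δ * (x + f 0 / δ) ≤ f x := by
    intro x hx
    have h := hf.secant_mono (a := 0) (x := y) (y := x) Set.self_mem_Ici hy0.le (hy0.trans hx).le
      hy0.ne' (hy0.trans hx).ne' hx.le
    simp only [sub_zero] at h
    rw [← hδ, le_div_iff₀ (hy0.trans hx)] at h
    have : δ * (x + f 0 / δ) = δ * x + f 0 := by field_simp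
    linarith
  have hmeas : AEStronglyMeasurable (fun x => x * f x ^ q) (volume.restrict (Set.Ioi 0)) :=
    aestronglyMeasurable_id.mul hint.aestronglyMeasurable
  have hc : 0 < f 0 / δ := div_pos h0 hδ0
  have hI := ((integrableOn_add_rpow_Ioi_of_lt (a := q + 1) (c := 0) (m := f 0 / δ)
    (by linarith) (by linarith)).const_mul (δ ^ q)).add (hint.const_mul y)
  refine Integrable.mono' hI hmeas ?_
  filter_upwards [ae_restrict_mem measurableSet_Ioi] with x hx
  have hx : 0 < x := hx
  have hfx := hpos x hx.le
  have hfq : 0 < f x ^ q := Real.rpow_pos_of_pos hfx q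
  rw [Real.norm_of_nonneg (by positivity)]
  have hxc : 0 < x + f 0 / δ := by positivity
  have hnn : 0 ≤ δ ^ q * (x + f 0 / δ) ^ (q + 1) := by positivity
  simp only [Pi.add_apply]
  rcases le_or_gt x y with hxy | hxy
  · nlinarith
  · have h1 : f x ^ q ≤ δ ^ q * (x + f 0 / δ) ^ q := by
      rw [← Real.mul_rpow hδ0.le hxc.le]
      exact Real.rpow_le_rpow_of_nonpos (by positivity) (hlow x hxy) (by linarith)
    have h2 : x * f x ^ q ≤ (x + f 0 / δ) * (δ ^ q * (x + f 0 / δ) ^ q) := by gcongr; linarith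
    rw [Real.rpow_add_one hxc.ne']
    nlinarith [mul_pos hy0 hfq]

/-- If `D` has zero integral over the negative half-line and changes sign there at most once, from
negative to nonnegative, then it is nonnegative somewhere and its sign changes at some point. -/
lemma exists_sign_change_of_setIntegral_eq_zero {D : ℝ → ℝ} (hD : IntegrableOn D (Set.Iio 0))
    (hzero : ∫ x in Set.Iio (0 : ℝ), D x = 0)
    (hup : ∀ x y, x < y → y < 0 → 0 ≤ D x → 0 ≤ D y) :
    (∃ s < 0, 0 ≤ D s) ∧ ∃ x₀, ∀ᵐ x, x < 0 → 0 ≤ (x - x₀) * D x := by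
  have hne : ∃ s < 0, 0 ≤ D s := by
    by_contra! hcon
    have h0 : 0 ≤ᵐ[volume.restrict (Set.Iio 0)] fun x => -D x := by
      filter_upwards [ae_restrict_mem measurableSet_Iio] with x hx
      exact (neg_pos.2 (hcon x hx)).le
    have h1 := (setIntegral_eq_zero_iff_of_nonneg_ae h0 hD.neg).1
      (by rw [integral_neg, hzero, neg_zero])
    have h2 : ∀ᵐ x ∂volume.restrict (Set.Iio (0 : ℝ)), False := by
      filter_upwards [h1, ae_restrict_mem measurableSet_Iio] with x hx hx0
      exact (neg_pos.2 (hcon x hx0)).ne' hx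
    rw [Filter.eventually_false_iff_eq_bot, ae_eq_bot, Measure.restrict_eq_zero] at h2
    simp at h2
  refine ⟨hne, ?_⟩
  by_cases hbdd : BddBelow {x | x < 0 ∧ 0 ≤ D x}
  · refine ⟨sInf {x | x < 0 ∧ 0 ≤ D x}, Filter.Eventually.of_forall fun x hx => ?_⟩
    rcases lt_trichotomy x (sInf {x | x < 0 ∧ 0 ≤ D x}) with h | h | h
    · have hDx : D x < 0 := by
        by_contra! hcon
        exact (notMem_of_lt_csInf h hbdd) ⟨hx, hcon⟩
      exact mul_nonneg_of_nonpos_of_nonpos (by linarith) hDx.le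
    · simp [← h]
    · obtain ⟨y, hy, hyx⟩ := exists_lt_of_csInf_lt hne h
      exact mul_nonneg (by linarith) (hup y x hyx hx hy.2)
  · have hall : ∀ x < 0, 0 ≤ D x := by
      intro x hx
      obtain ⟨y, hy, hyx⟩ := not_bddBelow_iff.1 hbdd x
      exact hup y x hyx hx hy.2
    have h0 : 0 ≤ᵐ[volume.restrict (Set.Iio 0)] D := by
      filter_upwards [ae_restrict_mem measurableSet_Iio] with x hx
      exact hall x hx
    have h1 := (setIntegral_eq_zero_iff_of_nonneg_ae h0 hD).1 hzero
    refine ⟨0, ?_⟩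
    filter_upwards [(ae_restrict_iff' measurableSet_Iio).1 h1] with x hx hx0
    simp [hx hx0]

/-- A function with vanishing mass on both half-lines and vanishing first moment is zero if it
changes sign exactly once, upwards, on each half-line. -/
lemma ae_eq_zero_of_sign_change {D : ℝ → ℝ} {x₀ t : ℝ} (hD : Integrable D)
    (hxD : Integrable fun x => x * D x) (hzero : ∫ x, D x = 0)
    (hleft : ∫ x in Set.Iio (0 : ℝ), D x = 0) (hmom : ∫ x, x * D x = 0)
    (hneg : ∀ᵐ x, x < 0 → 0 ≤ (x - x₀) * D x) (hpos : ∀ᵐ x, 0 ≤ x → 0 ≤ (x - t) * D x) :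
    D =ᵐ[volume] 0 := by
  have hind : Integrable ((Set.Iio (0 : ℝ)).indicator D) := hD.indicator measurableSet_Iio
  have hsub : Integrable fun x => x * D x - t * D x := hxD.sub (hD.const_mul t)
  have hint := hsub.add (hind.const_mul (t - x₀))
  have hH : ∫ x, (x * D x - t * D x + (t - x₀) * (Set.Iio (0 : ℝ)).indicator D x) = 0 := by
    rw [integral_add hsub (hind.const_mul (t - x₀)),
      integral_sub hxD (hD.const_mul t), integral_const_mul, integral_const_mul,
      integral_indicator measurableSet_Iio, hzero, hleft, hmom]
    ring
  have hnn : 0 ≤ᵐ[volume] fun x =>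
      x * D x - t * D x + (t - x₀) * (Set.Iio (0 : ℝ)).indicator D x := by
    filter_upwards [hneg, hpos] with x h1 h2
    simp only [Pi.zero_apply]
    rcases lt_or_ge x 0 with hx | hx
    · rw [Set.indicator_of_mem (Set.mem_Iio.2 hx)]
      linarith [h1 hx]
    · rw [Set.indicator_of_notMem (by simpa using hx)]
      linarith [h2 hx]
  have hz := (integral_eq_zero_iff_of_nonneg_ae hnn hint).1 hH
  filter_upwards [hz, compl_mem_ae_iff.2 (measure_singleton (μ := (volume : Measure ℝ)) x₀),
    compl_mem_ae_iff.2 (measure_singleton (μ := (volume : Measure ℝ)) t)] with x h h1 h2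
  have h1 : x - x₀ ≠ 0 := sub_ne_zero.2 h1
  have h2 : x - t ≠ 0 := sub_ne_zero.2 h2
  simp only [Pi.zero_apply] at h ⊢
  rcases lt_or_ge x 0 with hx | hx
  · rw [Set.indicator_of_mem (Set.mem_Iio.2 hx)] at h
    exact (mul_eq_zero.1 (by linarith : (x - x₀) * D x = 0)).resolve_left h1
  · rw [Set.indicator_of_notMem (by simpa using hx)] at h
    exact (mul_eq_zero.1 (by linarith : (x - t) * D x = 0)).resolve_left h2

lemma isOpen_erealIoo (a b : EReal) : IsOpen (erealIoo a b) :=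
  isOpen_Ioo.preimage continuous_coe_real_ereal

lemma zero_mem_erealIoo {a b : EReal} (ha : a < 0) (hb : 0 < b) : (0 : ℝ) ∈ erealIoo a b :=
  ⟨by simpa using ha, by simpa using hb⟩

/-- A density on `(a, b)` with a convex power of exponent `1 / q`, `q < -2`, has a finite first
moment on the positive half-line. -/
lemma integrableOn_mul_erealIoo_inter_Ioi {a b : EReal} {w : ℝ → ℝ} {q : ℝ} (hq : q < -2)
    (ha : a < 0) (hb : 0 < b) (hw : ∀ x ∈ erealIoo a b, 0 < w x)
    (hint : IntegrableOn w (erealIoo a b))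
    (hconv : ConvexOn ℝ (erealIoo a b) (fun x => w x ^ (1 / q))) :
    IntegrableOn (fun x => x * w x) (erealIoo a b ∩ Set.Ioi 0) := by
  have hmeas : MeasurableSet (erealIoo a b ∩ Set.Ioi 0) :=
    (isOpen_erealIoo a b).measurableSet.inter measurableSet_Ioi
  have hint' : IntegrableOn w (erealIoo a b ∩ Set.Ioi 0) := hint.mono_set Set.inter_subset_left
  induction b with
  | bot => simp at hb
  | coe r =>
    refine Integrable.mono' (hint'.const_mul r)
      (aestronglyMeasurable_id.mul hint'.aestronglyMeasurable) ?_
    filter_upwards [ae_restrict_mem hmeas] with x hx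
    have hxr : x < r := EReal.coe_lt_coe_iff.1 hx.1.2
    have hx0 : 0 < x := hx.2
    have := hw x hx.1
    rw [Real.norm_of_nonneg (by positivity)]
    gcongr
  | top =>
    have hsub : Set.Ici (0 : ℝ) ⊆ erealIoo a ⊤ := fun x hx =>
      ⟨ha.trans_le (EReal.coe_nonneg.2 hx), EReal.coe_lt_top x⟩
    have heq : erealIoo a ⊤ ∩ Set.Ioi 0 = Set.Ioi 0 :=
      Set.inter_eq_right.2 (Set.Ioi_subset_Ici_self.trans hsub)
    rw [heq] at hint' ⊢
    have hpow : ∀ x ∈ Set.Ioi (0 : ℝ), w x = (w x ^ (1 / q)) ^ q := fun x hx => by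
      rw [← Real.rpow_mul (hw x (hsub (Set.Ioi_subset_Ici_self hx))).le,
        one_div_mul_cancel (by linarith), Real.rpow_one]
    have h := integrableOn_mul_rpow_Ioi_of_convexOn hq (hconv.subset hsub (convex_Ici 0))
      (fun x hx => Real.rpow_pos_of_pos (hw x (hsub hx)) _)
      (hint'.congr_fun hpow measurableSet_Ioi)
    exact h.congr_fun (fun x hx => by simp only [← hpow x hx]) measurableSet_Ioi

lemma false_of_ae_eq_zero_of_isOpen {D : ℝ → ℝ} {s : Set ℝ} (hD : D =ᵐ[volume] 0)
    (hs : IsOpen s) (hne : s.Nonempty) (h : ∀ x ∈ s, D x ≠ 0) : False := by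
  have hpos := hs.measure_pos volume hne
  refine hpos.ne' (measure_mono_null (fun x hx => ?_) (ae_iff.1 hD))
  exact h x hx

/-- The difference of two densities on an interval and on a half-line `(-∞, t)` vanishes almost
everywhere only if these sets agree. -/
lemma erealIoo_eq_of_indicator_sub_ae_eq_zero {a b : EReal} {w u : ℝ → ℝ} {t : ℝ}
    (ha : a < 0) (hb : 0 < b) (ht : 0 < t)
    (hw : ∀ x ∈ erealIoo a b, 0 < w x) (hu : ∀ x < t, 0 < u x)
    (h : (fun x => (erealIoo a b).indicator w x - (Set.Iio t).indicator u x) =ᵐ[volume] 0) :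
    a = ⊥ ∧ b = (t : EReal) := by
  have h1 : ∀ s : Set ℝ, IsOpen s → s.Nonempty → (∀ x ∈ s, x ∉ erealIoo a b ∧ x < t) → False := by
    intro s hs hne hx
    refine false_of_ae_eq_zero_of_isOpen h hs hne fun x hxs => ?_
    obtain ⟨h2, h3⟩ := hx x hxs
    simp only [Set.indicator_of_notMem h2, Set.indicator_of_mem (Set.mem_Iio.2 h3)]
    linarith [hu x h3]
  have h2 : ∀ s : Set ℝ, IsOpen s → s.Nonempty → (∀ x ∈ s, x ∈ erealIoo a b ∧ t ≤ x) → False := by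
    intro s hs hne hx
    refine false_of_ae_eq_zero_of_isOpen h hs hne fun x hxs => ?_
    obtain ⟨h2, h3⟩ := hx x hxs
    simp only [Set.indicator_of_mem h2, Set.indicator_of_notMem (by simpa using h3 : x ∉ Set.Iio t)]
    linarith [hw x h2]
  constructor
  · induction a with
    | bot => rfl
    | top => simp at ha
    | coe r =>
      have hr : r < 0 := by exact_mod_cast ha
      refine (h1 (Set.Iio r) isOpen_Iio Set.nonempty_Iio fun x hx => ⟨fun hxI => ?_, ?_⟩).elim
      · exact lt_asymm hx (EReal.coe_lt_coe_iff.1 hxI.1)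
      · exact (Set.mem_Iio.1 hx).trans (hr.trans ht)
  · have hax : ∀ x : ℝ, 0 < x → a < x := fun x hx => ha.trans (EReal.coe_pos.2 hx)
    induction b with
    | bot => simp at hb
    | top =>
      exact (h2 (Set.Ioi t) isOpen_Ioi Set.nonempty_Ioi fun x hx =>
        ⟨⟨hax x (ht.trans hx), EReal.coe_lt_top x⟩, le_of_lt hx⟩).elim
    | coe r =>
      have hr : 0 < r := by exact_mod_cast hb
      rcases lt_trichotomy r t with hrt | hrt | hrt
      · exact (h1 (Set.Ioo r t) isOpen_Ioo (Set.nonempty_Ioo.2 hrt) fun x hx =>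
          ⟨fun hxI => lt_asymm hx.1 (EReal.coe_lt_coe_iff.1 hxI.2), hx.2⟩).elim
      · rw [hrt]
      · exact (h2 (Set.Ioo t r) isOpen_Ioo (Set.nonempty_Ioo.2 hrt) fun x hx =>
          ⟨⟨hax x (ht.trans hx.1), EReal.coe_lt_coe_iff.2 hx.2⟩, hx.1.le⟩).elim

/-- The model density with parameter `c` has total mass one, barycenter `0` and mass
`(N / (N + 1)) ^ N` on the negative half-line. -/
lemma model_density_integrals {N c : ℝ} (hN : N < -1) (hc : 0 < c) :
    ∫ x in Set.Iio (1 / c), c * (N / (N + 1)) ^ N * (1 + c / N * x) ^ (N - 1) = 1 ∧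
    ∫ x in Set.Iio (1 / c), x * (c * (N / (N + 1)) ^ N * (1 + c / N * x) ^ (N - 1)) = 0 ∧
    ∫ x in Set.Iio (0 : ℝ), c * (N / (N + 1)) ^ N * (1 + c / N * x) ^ (N - 1) =
      (N / (N + 1)) ^ N := by
  have hN0 : N ≠ 0 := by linarith
  have hN1 : N + 1 ≠ 0 := by linarith
  have hk : c / N < 0 := div_neg_of_pos_of_neg hc (by linarith)
  have hz : 1 + c / N * (1 / c) = (N + 1) / N := by field_simp
  have hzpos : 0 < (N + 1) / N := div_pos_of_neg_of_neg (by linarith) (by linarith)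
  have hKz : (N / (N + 1)) ^ N * ((N + 1) / N) ^ N = 1 := by
    rw [← Real.mul_rpow (div_pos_of_neg_of_neg (by linarith) (by linarith)).le hzpos.le,
      div_mul_div_cancel₀ hN1, div_self hN0, Real.one_rpow]
  have h1 : 0 < 1 + c / N * (1 / c) := hz ▸ hzpos
  refine ⟨?_, ?_, ?_⟩
  · rw [integral_const_mul, integral_one_add_mul_rpow_Iio hk (by linarith) h1, hz,
      sub_add_cancel, div_mul_cancel₀ _ hN0]
    refine Eq.trans ?_ hKz
    field_simp
  · simp_rw [mul_left_comm _ (c * (N / (N + 1)) ^ N)]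
    rw [integral_const_mul, integral_mul_one_add_mul_rpow_Iio hk (by linarith) h1, hz,
      sub_add_cancel, show N - 1 + 2 = N + 1 by ring, Real.rpow_add_one hzpos.ne']
    field_simp
    ring
  · rw [integral_const_mul, integral_one_add_mul_rpow_Iio hk (by linarith) (by simp),
      sub_add_cancel, div_mul_cancel₀ _ hN0]
    simp
    field_simp

/-- Rigidity in the one-dimensional Grünbaum inequality for `N < -1`: equality
`∫_a^0 w = (N/(N+1))^N` forces `a = -∞`, `b = 1/c` and the model density. -/
theorem grunbaum_one_dim_neg_rigidity (N : ℝ) (a b : EReal) (w : ℝ → ℝ)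
    (hN : N < -1) (ha : a < (0 : EReal)) (hb : (0 : EReal) < b)
    (hw : ∀ x ∈ erealIoo a b, 0 < w x)
    (hint : IntegrableOn w (erealIoo a b))
    (hconv : ConvexOn ℝ (erealIoo a b) (fun x => w x ^ (1 / (N - 1))))
    (hmass : ∫ x in erealIoo a b, w x = 1)
    (hbar : ∫ x in erealIoo a b, x * w x = 0)
    (heq : ∫ x in erealIoo a b ∩ Set.Iio (0 : ℝ), w x = (N / (N + 1)) ^ N) :
    ∃ c > 0, a = ⊥ ∧ b = ((1 / c : ℝ) : EReal) ∧
      ∀ x ∈ erealIoo a b,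
        w x = c * (N / (N + 1)) ^ N * (1 + (c / N) * x) ^ (N - 1) := by
  have hN0 : N < 0 := by linarith
  have hq : N - 1 < -2 := by linarith
  have hKpos : 0 < (N / (N + 1)) ^ N :=
    Real.rpow_pos_of_pos (div_pos_of_neg_of_neg hN0 (by linarith)) N
  have h0I := zero_mem_erealIoo ha hb
  have hImeas : MeasurableSet (erealIoo a b) := (isOpen_erealIoo a b).measurableSet
  set K := (N / (N + 1)) ^ N with hK
  set I := erealIoo a b with hI
  obtain ⟨c, hcdef⟩ : ∃ c, c = w 0 / K := ⟨_, rfl⟩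
  have hc : 0 < c := hcdef ▸ div_pos (hw 0 h0I) hKpos
  have hw0 : c * K = w 0 := by rw [hcdef, div_mul_cancel₀ _ hKpos.ne']
  obtain ⟨hU1, hU2, hU3⟩ := model_density_integrals hN hc
  rw [← hK] at hU1 hU2 hU3
  have hk : c / N < 0 := div_neg_of_pos_of_neg hc hN0
  have ht : 0 < 1 / c := one_div_pos.2 hc
  have htpos : 0 < 1 + c / N * (1 / c) := by
    rw [show 1 + c / N * (1 / c) = (N + 1) / N by field_simp [hN0.ne]]
    exact div_pos_of_neg_of_neg (by linarith) hN0
  have hg : ∀ x < 1 / c, 0 < 1 + c / N * x := fun x hx => one_add_mul_pos_of_lt hk htpos hx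
  set t := 1 / c with ht_def
  set u : ℝ → ℝ := fun x => c * K * (1 + c / N * x) ^ (N - 1) with hu
  have hupos : ∀ x < t, 0 < u x := fun x hx =>
    mul_pos (mul_pos hc hKpos) (Real.rpow_pos_of_pos (hg x hx) _)
  have huint : IntegrableOn u (Set.Iio t) :=
    (integrableOn_one_add_mul_rpow_Iio hk (by linarith) htpos).const_mul _
  have huxint : IntegrableOn (fun x => x * u x) (Set.Iio t) := by
    refine IntegrableOn.congr_fun
      ((integrableOn_mul_one_add_mul_rpow_Iio hk hq htpos).const_mul (c * K)) (fun x _ => ?_)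
      measurableSet_Iio
    simp only [hu]
    ring
  set D : ℝ → ℝ := fun x => I.indicator w x - (Set.Iio t).indicator u x with hD
  have hWint : Integrable (I.indicator w) := hint.integrable_indicator hImeas
  have hUint : Integrable ((Set.Iio t).indicator u) := huint.integrable_indicator measurableSet_Iio
  have hDint : Integrable D := hWint.sub hUint
  have hDzero : ∫ x, D x = 0 := by
    rw [integral_sub hWint hUint, integral_indicator hImeas, integral_indicator measurableSet_Iio,
      hmass, hU1, sub_self]
  have hDleft : ∫ x in Set.Iio (0 : ℝ), D x = 0 := by
    rw [integral_sub hWint.integrableOn hUint.integrableOn, setIntegral_indicator hImeas,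
      setIntegral_indicator measurableSet_Iio, Set.inter_comm, heq, Set.Iio_inter_Iio,
      min_eq_left ht.le, hU3, sub_self]
  -- comparison of `w` with the model in terms of the convex function `w ^ (1 / (N - 1))`
  set f : ℝ → ℝ := fun x => w x ^ (1 / (N - 1)) with hf
  have hfpos : ∀ x ∈ I, 0 < f x := fun x hx => Real.rpow_pos_of_pos (hw x hx) _
  have hwf : ∀ x ∈ I, w x = f x ^ (N - 1) := fun x hx => by
    simp only [hf]
    rw [← Real.rpow_mul (hw x hx).le, one_div_mul_cancel (by linarith), Real.rpow_one]
  have huf : ∀ x < t, u x = (f 0 * (1 + c / N * x)) ^ (N - 1) := fun x hx => by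
    rw [Real.mul_rpow (hfpos 0 h0I).le (hg x hx).le, ← hwf 0 h0I]
    simp only [hu, hw0]
  have hle : ∀ x < t, x ∈ I → (u x ≤ w x ↔ f x ≤ f 0 * (1 + c / N * x)) := fun x hx hxI => by
    rw [hwf x hxI, huf x hx, Real.rpow_le_rpow_iff_of_neg (mul_pos (hfpos 0 h0I) (hg x hx))
      (hfpos x hxI) (by linarith)]
  have hge : ∀ x < t, x ∈ I → (w x ≤ u x ↔ f 0 * (1 + c / N * x) ≤ f x) := fun x hx hxI => by
    rw [hwf x hxI, huf x hx, Real.rpow_le_rpow_iff_of_neg (hfpos x hxI)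
      (mul_pos (hfpos 0 h0I) (hg x hx)) (by linarith)]
  have hDmem : ∀ x < t, x ∈ I → D x = w x - u x := fun x hx hxI => by
    simp only [hD, Set.indicator_of_mem hxI, Set.indicator_of_mem (Set.mem_Iio.2 hx)]
  have hDnotMem : ∀ x < t, x ∉ I → D x = - u x := fun x hx hxI => by
    simp only [hD, Set.indicator_of_notMem hxI, Set.indicator_of_mem (Set.mem_Iio.2 hx), zero_sub]
  have hDsign : ∀ x < t, 0 ≤ D x ↔ x ∈ I ∧ f x ≤ f 0 * (1 + c / N * x) := fun x hx => by
    by_cases hxI : x ∈ I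
    · rw [hDmem x hx hxI, sub_nonneg, hle x hx hxI]
      simp [hxI]
    · rw [hDnotMem x hx hxI]
      simp [hxI, hupos x hx]
  have hsec : ∀ x y z, x < y → y < z → x ∈ I → z ∈ I →
      y ∈ I ∧ (z - x) * f y ≤ (z - y) * f x + (y - x) * f z := fun x y z hxy hyz hx hz => by
    have h1 := hconv.secant_mono_aux1 hx hz hxy hyz
    exact ⟨hconv.1.ordConnected.out hx hz ⟨hxy.le, hyz.le⟩, h1⟩
  obtain ⟨⟨s, hs0, hDs⟩, x₀, hx₀⟩ := exists_sign_change_of_setIntegral_eq_zero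
    hDint.integrableOn hDleft fun x y hxy hy0 hDx => by
      rw [hDsign x (by linarith)] at hDx
      rw [hDsign y (by linarith)]
      obtain ⟨hyI, h⟩ := hsec x y 0 hxy hy0 hDx.1 h0I
      refine ⟨hyI, ?_⟩
      have : (0 - x) * f y ≤ (0 - x) * (f 0 * (1 + c / N * y)) := by
        nlinarith [mul_le_mul_of_nonneg_left hDx.2 (by linarith : 0 ≤ 0 - y)]
      exact le_of_mul_le_mul_left this (by linarith)
  obtain ⟨hsI, hfs⟩ := (hDsign s (by linarith)).1 hDs
  have hright : ∀ x, 0 ≤ x → 0 ≤ (x - t) * D x := by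
    intro x hx
    rcases lt_or_ge x t with hxt | hxt
    · refine mul_nonneg_of_nonpos_of_nonpos (by linarith) ?_
      by_cases hxI : x ∈ I
      · rw [hDmem x hxt hxI, sub_nonpos, hge x hxt hxI]
        rcases hx.eq_or_lt with rfl | hx
        · simp
        · obtain ⟨-, h⟩ := hsec s 0 x hs0 hx hsI hxI
          have : (0 - s) * (f 0 * (1 + c / N * x)) ≤ (0 - s) * f x := by
            nlinarith [mul_le_mul_of_nonneg_left hfs (by linarith : 0 ≤ x - 0)]
          exact le_of_mul_le_mul_left this (by linarith)
      · rw [hDnotMem x hxt hxI]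
        linarith [hupos x hxt]
    · refine mul_nonneg (by linarith) ?_
      simp only [hD, Set.indicator_of_notMem (by simpa using hxt : x ∉ Set.Iio t), sub_zero]
      exact Set.indicator_nonneg (fun y hy => (hw y hy).le) x
  -- the first moment
  have hmul : ∀ (s : Set ℝ) (v : ℝ → ℝ),
      (fun x => x * s.indicator v x) = s.indicator fun x => x * v x := fun s v =>
    funext fun x => (Set.indicator_mul_right s (fun x => x) v).symm
  have hxU : Integrable fun x => x * (Set.Iio t).indicator u x := by
    rw [hmul]
    exact huxint.integrable_indicator measurableSet_Iio
  have hxWmeas : AEStronglyMeasurable (fun x => x * I.indicator w x) :=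
    aestronglyMeasurable_id.mul hWint.aestronglyMeasurable
  have hxWleft : IntegrableOn (fun x => x * I.indicator w x) (Set.Iio 0) := by
    refine Integrable.mono' (hxU.norm.add (hWint.const_mul |x₀|)).integrableOn hxWmeas.restrict ?_
    filter_upwards [ae_restrict_mem measurableSet_Iio, ae_restrict_of_ae hx₀] with x hx hsign
    have hx : x < 0 := hx
    have hsign := hsign hx
    have hWnn : 0 ≤ I.indicator w x := Set.indicator_nonneg (fun y hy => (hw y hy).le) x
    have hUnn : 0 ≤ (Set.Iio t).indicator u x :=
      Set.indicator_nonneg (fun y hy => (hupos y hy).le) x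
    simp only [Pi.add_apply, norm_mul, Real.norm_eq_abs, abs_of_neg hx, abs_of_nonneg hWnn,
      abs_of_nonneg hUnn]
    simp only [hD] at hsign
    rcases le_or_gt x₀ x with h | h
    · have : -x ≤ |x₀| := by linarith [neg_le_abs x₀]
      nlinarith [mul_nonneg (neg_pos.2 hx).le hUnn]
    · have : I.indicator w x ≤ (Set.Iio t).indicator u x := by nlinarith
      nlinarith [mul_nonneg (abs_nonneg x₀) hWnn]
  have hxWright : IntegrableOn (fun x => x * I.indicator w x) (Set.Ici 0) := by
    rw [integrableOn_Ici_iff_integrableOn_Ioi]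
    have h := integrableOn_mul_erealIoo_inter_Ioi hq ha hb hw hint hconv
    rwa [hmul, integrableOn_indicator_iff hImeas]
  have hxW : Integrable fun x => x * I.indicator w x := by
    rw [← integrableOn_univ, ← Set.Iio_union_Ici (a := (0 : ℝ))]
    exact hxWleft.union hxWright
  have hxD : Integrable fun x => x * D x := by
    simp only [hD, mul_sub]
    exact hxW.sub hxU
  have hmom : ∫ x, x * D x = 0 := by
    simp only [hD, mul_sub]
    rw [integral_sub hxW hxU, hmul, hmul, integral_indicator hImeas,
      integral_indicator measurableSet_Iio, hbar, hU2, sub_self]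
  have hDae := ae_eq_zero_of_sign_change hDint hxD hDzero hDleft hmom hx₀
    (Filter.Eventually.of_forall hright)
  obtain ⟨hab, hbt⟩ := erealIoo_eq_of_indicator_sub_ae_eq_zero ha hb ht hw hupos hDae
  refine ⟨c, hc, hab, hbt, ?_⟩
  have hIt : ∀ x ∈ I, x < t := fun x hx => by
    have := hx.2
    rw [hbt] at this
    exact EReal.coe_lt_coe_iff.1 this
  refine Measure.eqOn_open_of_ae_eq (μ := volume) (f := w) (g := u) ?_ (isOpen_erealIoo a b) ?_ ?_
  · filter_upwards [ae_restrict_mem hImeas, ae_restrict_of_ae hDae] with x hx h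
    rw [hDmem x (hIt x hx) hx] at h
    exact sub_eq_zero.1 h
  · exact ((hconv.continuousOn (isOpen_erealIoo a b)).rpow_const
      fun x hx => Or.inl (hfpos x hx).ne').congr hwf
  · exact continuousOn_const.mul (ContinuousOn.rpow_const (by fun_prop)
      fun x hx => Or.inl (hg x (hIt x hx)).ne')
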